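/- arXiv:2402.17530 — 3 statements merged into one kernel-verified Lean document; each statement's English description precedes it below -/
import Mathlib

section
/- Let g be an invertible symmetric real 4×4 matrix with inverse h. Let ℓ_A, ℓ_B ∈ ℝ⁴ be covectors with h(ℓ_A,ℓ_A) = h(ℓ_B,ℓ_B) = 0, and let F_A, F_B be symmetric 4×4 matrices with tr_g F_A = tr_g F_B = 0, (F_A)_{μν} L_A^ν = 0 for every μ, and (F_B)_{μν} L_B^ν = 0 for every μ. Then for each sign ε ∈ {+1, −1}, the symmetric matrix 𝓘^{(0,ε)} built from (ℓ_A, ℓ_B, F_A, F_B, ε) satisfies Pol(𝓘^{(0,ε)}, ℓ_A + ε ℓ_B) = 0. (This is the key algebraic 'transparency' identity that allows the interaction of two null waves to be absorbed by an algebraic corrector.) -/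
open BigOperators

noncomputable section

/-- `h(v,w) := h^{μν} v_μ w_ν`. -/
def hBil (h : Fin 4 → Fin 4 → ℝ) (v w : Fin 4 → ℝ) : ℝ := ∑ μ, ∑ ν, h μ ν * v μ * w ν

/-- The vector `L^μ := −h^{μν} ℓ_ν` associated to a covector `ℓ`. -/
def vecOf (h : Fin 4 → Fin 4 → ℝ) (ℓ : Fin 4 → ℝ) : Fin 4 → ℝ := fun μ => -∑ ν, h μ ν * ℓ ν

/-- `|P·Q|_g := h^{αβ} h^{μν} P_{αμ} Q_{βν}`. -/
def dotg (h P Q : Fin 4 → Fin 4 → ℝ) : ℝ :=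
  ∑ α, ∑ β, ∑ μ, ∑ ν, h α β * h μ ν * P α μ * Q β ν

/-- `P(X)_α := P_{αμ} X^μ`. -/
def app1 (P : Fin 4 → Fin 4 → ℝ) (X : Fin 4 → ℝ) : Fin 4 → ℝ := fun α => ∑ μ, P α μ * X μ

/-- `P(X,Y) := P_{μν} X^μ Y^ν`. -/
def app2 (P : Fin 4 → Fin 4 → ℝ) (X Y : Fin 4 → ℝ) : ℝ := ∑ μ, ∑ ν, P μ ν * X μ * Y ν

/-- `M(P,Q;X)_β := X^μ P_{μσ} h^{σν} Q_{νβ}`. -/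
def Mop (h P Q : Fin 4 → Fin 4 → ℝ) (X : Fin 4 → ℝ) : Fin 4 → ℝ :=
  fun β => ∑ μ, ∑ σ, ∑ ν, X μ * P μ σ * h σ ν * Q ν β

/-- The quadratic interaction tensor `P^{(0,ε)}`. -/
def P0 (h FA FB : Fin 4 → Fin 4 → ℝ) (ℓA ℓB : Fin 4 → ℝ) (ε : ℝ) : Fin 4 → Fin 4 → ℝ :=
  fun α β =>
    (1 / 4) * ( ε * (ℓA α * Mop h FA FB (vecOf h ℓB) β + ℓA β * Mop h FA FB (vecOf h ℓB) α)
      + ε * (ℓB α * Mop h FB FA (vecOf h ℓA) β + ℓB β * Mop h FB FA (vecOf h ℓA) α)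
      + (ε / 2) * (ℓA α * ℓB β + ℓA β * ℓB α) * dotg h FA FB
      + ε * (app1 FA (vecOf h ℓB) α * app1 FB (vecOf h ℓA) β
           + app1 FA (vecOf h ℓB) β * app1 FB (vecOf h ℓA) α)
      - ε * hBil h ℓA ℓB * (∑ σ, ∑ ν, h σ ν * (FA α σ * FB ν β + FA β σ * FB ν α)) )

/-- The covector `J` appearing in `𝓘^{(0,ε)}`. -/
def Jcov (h FA FB : Fin 4 → Fin 4 → ℝ) (ℓA ℓB : Fin 4 → ℝ) (ε : ℝ) : Fin 4 → ℝ :=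
  fun β => -(1 / 8) * dotg h FA FB * (ℓA β + ε * ℓB β)
    - (1 / 4) * Mop h FB FA (vecOf h ℓA) β
    - (ε / 4) * Mop h FA FB (vecOf h ℓB) β

/-- The interaction source tensor `𝓘^{(0,ε)}`. -/
def Icor (h FA FB : Fin 4 → Fin 4 → ℝ) (ℓA ℓB : Fin 4 → ℝ) (ε : ℝ) : Fin 4 → Fin 4 → ℝ :=
  fun α β =>
    -(1 / 4) * (app2 FB (vecOf h ℓA) (vecOf h ℓA) * FA α β
            + app2 FA (vecOf h ℓB) (vecOf h ℓB) * FB α β)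
    + P0 h FA FB ℓA ℓB ε α β
    + (ℓA α + ε * ℓB α) * Jcov h FA FB ℓA ℓB ε β
    + (ℓA β + ε * ℓB β) * Jcov h FA FB ℓA ℓB ε α

/-- The polarization covector `Pol(S,v)_α = h^{μν} S_{αμ} v_ν − (1/2)(tr_g S) v_α`. -/
def Pol (h S : Fin 4 → Fin 4 → ℝ) (v : Fin 4 → ℝ) : Fin 4 → ℝ :=
  fun α => (∑ μ, ∑ ν, h μ ν * S α μ * v ν)
    - (1 / 2) * (∑ μ, ∑ ν, h μ ν * S μ ν) * v α

end

section

open Matrix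

/-- The symmetrized outer product `x_α y_β + x_β y_α`. -/
def symOuter {n : Type*} (x y : n → ℝ) : Matrix n n ℝ := vecMulVec x y + vecMulVec y x

theorem symOuter_mulVec {n : Type*} [Fintype n] (x y z : n → ℝ) :
    symOuter x y *ᵥ z = (y ⬝ᵥ z) • x + (x ⬝ᵥ z) • y := by
  simp [symOuter, add_mulVec, vecMulVec_mulVec]

theorem dotProduct_mulVec_comm_of_symm {n : Type*} [Fintype n] {S : Matrix n n ℝ} (hS : Sᵀ = S)
    (x y : n → ℝ) : x ⬝ᵥ S *ᵥ y = y ⬝ᵥ S *ᵥ x := by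
  rw [dotProduct_mulVec, ← mulVec_transpose, hS, dotProduct_comm]

theorem trace_mul_symOuter {n : Type*} [Fintype n] {H : Matrix n n ℝ} (hH : Hᵀ = H)
    (x y : n → ℝ) : (H * symOuter x y).trace = 2 * (x ⬝ᵥ H *ᵥ y) := by
  rw [symOuter, mul_add, trace_add, mul_vecMulVec, mul_vecMulVec, trace_vecMulVec,
    trace_vecMulVec, dotProduct_comm (H *ᵥ x) y, dotProduct_comm (H *ᵥ y) x,
    dotProduct_mulVec_comm_of_symm hH y x]
  ring

theorem hBil_eq_dotProduct (H : Matrix (Fin 4) (Fin 4) ℝ) (v w : Fin 4 → ℝ) :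
    hBil H v w = v ⬝ᵥ H *ᵥ w := by
  simp only [hBil, dotProduct, mulVec, Finset.mul_sum]
  exact Finset.sum_congr rfl fun _ _ => Finset.sum_congr rfl fun _ _ => by ring

theorem vecOf_eq_neg_mulVec (H : Matrix (Fin 4) (Fin 4) ℝ) (v : Fin 4 → ℝ) :
    vecOf H v = -(H *ᵥ v) := rfl

theorem app1_eq_mulVec (P : Matrix (Fin 4) (Fin 4) ℝ) (X : Fin 4 → ℝ) : app1 P X = P *ᵥ X := rfl

theorem app2_eq_dotProduct (P : Matrix (Fin 4) (Fin 4) ℝ) (X Y : Fin 4 → ℝ) :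
    app2 P X Y = X ⬝ᵥ P *ᵥ Y := by
  simp only [app2, dotProduct, mulVec, Finset.mul_sum]
  exact Finset.sum_congr rfl fun _ _ => Finset.sum_congr rfl fun _ _ => by ring

theorem Mop_eq_mulVec {H P Q : Matrix (Fin 4) (Fin 4) ℝ} (hH : Hᵀ = H) (hP : Pᵀ = P)
    (hQ : Qᵀ = Q) (X : Fin 4 → ℝ) : Mop H P Q X = Q *ᵥ H *ᵥ P *ᵥ X := by
  have h1 : Q *ᵥ H *ᵥ P *ᵥ X = X ᵥ* (P * (H * Q)) := by
    rw [← mulVec_transpose, transpose_mul, transpose_mul, hH, hP, hQ, mulVec_mulVec,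
      mulVec_mulVec, Matrix.mul_assoc]
  rw [h1]
  ext β
  simp only [Mop, vecMul, dotProduct, mul_apply, Finset.mul_sum]
  exact Finset.sum_congr rfl fun _ _ => Finset.sum_congr rfl fun _ _ =>
    Finset.sum_congr rfl fun _ _ => by ring

theorem dotg_eq_trace {H P Q : Matrix (Fin 4) (Fin 4) ℝ} (hH : Hᵀ = H) (hQ : Qᵀ = Q) :
    dotg H P Q = (H * (P * H * Q)).trace := by
  simp only [dotg, trace, diag, mul_apply, Finset.mul_sum, Finset.sum_mul]
  rw [Finset.sum_comm]
  refine Finset.sum_congr rfl fun β _ => Finset.sum_congr rfl fun α _ => ?_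
  rw [Finset.sum_comm]
  refine Finset.sum_congr rfl fun ν _ => Finset.sum_congr rfl fun μ _ => ?_
  rw [← congrFun (congrFun hH α) β, ← congrFun (congrFun hQ β) ν]
  simp only [transpose_apply]
  ring

theorem Pol_eq_mulVec_sub_trace {H : Matrix (Fin 4) (Fin 4) ℝ} (hH : Hᵀ = H)
    (S : Matrix (Fin 4) (Fin 4) ℝ) (v : Fin 4 → ℝ) :
    Pol H S v = S *ᵥ H *ᵥ v - (1 / 2 * (H * S).trace) • v := by
  have h1 : (∑ μ, ∑ ν, H μ ν * S μ ν) = (H * S).trace := by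
    simp only [trace, diag, mul_apply]
    rw [Finset.sum_comm]
    refine Finset.sum_congr rfl fun ν _ => Finset.sum_congr rfl fun μ _ => ?_
    rw [← congrFun (congrFun hH ν) μ, transpose_apply]
  ext α
  simp only [Pol, h1, Pi.sub_apply, Pi.smul_apply, smul_eq_mul, mulVec, dotProduct,
    Finset.mul_sum]
  congr 1
  exact Finset.sum_congr rfl fun _ _ => Finset.sum_congr rfl fun _ _ => by ring

theorem Icor_eq_matrix {H A B : Matrix (Fin 4) (Fin 4) ℝ} (hA : Aᵀ = A) (hB : Bᵀ = B)
    (hH : Hᵀ = H) (a b : Fin 4 → ℝ) (ε : ℝ) :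
    Icor H A B a b ε =
      (-(1 / 4) * app2 B (vecOf H a) (vecOf H a)) • A
      + (-(1 / 4) * app2 A (vecOf H b) (vecOf H b)) • B
      + (ε / 4) • symOuter a (Mop H A B (vecOf H b))
      + (ε / 4) • symOuter b (Mop H B A (vecOf H a))
      + (ε / 8 * dotg H A B) • symOuter a b
      + (ε / 4) • symOuter (app1 A (vecOf H b)) (app1 B (vecOf H a))
      + (-(ε / 4) * hBil H a b) • (A * H * B + B * H * A)
      + symOuter (a + ε • b) (Jcov H A B a b ε) := by
  have h1 (α β) : (∑ σ, ∑ ν, H σ ν * (A α σ * B ν β + A β σ * B ν α))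
      = (A * H * B + B * H * A) α β := by
    have h2 : B * H * A = (A * H * B)ᵀ := by
      rw [transpose_mul, transpose_mul, hA, hB, hH, Matrix.mul_assoc]
    rw [h2]
    simp only [Matrix.add_apply, transpose_apply, mul_apply, Finset.sum_mul]
    rw [Finset.sum_comm, ← Finset.sum_add_distrib]
    refine Finset.sum_congr rfl fun _ _ => ?_
    rw [← Finset.sum_add_distrib]
    exact Finset.sum_congr rfl fun _ _ => by ring
  ext α β
  simp only [Icor, P0, h1]
  simp only [symOuter, Matrix.add_apply, Matrix.smul_apply, vecMulVec_apply, smul_eq_mul,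
    Pi.add_apply, Pi.smul_apply]
  ring

theorem transpose_eq_self_of_mul_eq_one {n : Type*} [Fintype n] [DecidableEq n]
    {G H : Matrix n n ℝ} (hG : Gᵀ = G) (hGH : G * H = 1) : Hᵀ = H := by
  have h1 : Hᵀ * G = 1 := by rw [← hG, ← transpose_mul, hGH, transpose_one]
  calc Hᵀ = Hᵀ * (G * H) := by rw [hGH, Matrix.mul_one]
    _ = H := by rw [← Matrix.mul_assoc, h1, Matrix.one_mul]


theorem Pol_Icor_eq_zero {H A B : Matrix (Fin 4) (Fin 4) ℝ} (hA : Aᵀ = A) (hB : Bᵀ = B)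
    (hH : Hᵀ = H) {a b : Fin 4 → ℝ} (ha : a ⬝ᵥ H *ᵥ a = 0) (hb : b ⬝ᵥ H *ᵥ b = 0)
    (trA : (H * A).trace = 0) (trB : (H * B).trace = 0)
    (hAa : A *ᵥ H *ᵥ a = 0) (hBb : B *ᵥ H *ᵥ b = 0) {ε : ℝ} (hε : ε ^ 2 = 1) :
    Pol H (Icor H A B a b ε) (a + ε • b) = 0 := by
  set α := H *ᵥ a with hα
  set β := H *ᵥ b with hβ
  set u := A *ᵥ β with hu
  set v := B *ᵥ α with hv
  set m := B *ᵥ H *ᵥ u with hm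
  set n := A *ᵥ H *ᵥ v with hn
  set k := a ⬝ᵥ β with hk
  set d := (H * (A * H * B)).trace with hd
  set s := u ⬝ᵥ H *ᵥ v with hs
  have hvu : v ⬝ᵥ H *ᵥ u = s := dotProduct_mulVec_comm_of_symm hH _ _
  have kba : b ⬝ᵥ α = k := dotProduct_mulVec_comm_of_symm hH _ _
  have ma : m ⬝ᵥ α = s := by
    rw [dotProduct_comm, hm, dotProduct_mulVec_comm_of_symm hB, dotProduct_comm, hvu]
  have mb : m ⬝ᵥ β = 0 := by
    rw [dotProduct_comm, hm, dotProduct_mulVec_comm_of_symm hB, hBb, dotProduct_zero]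
  have na : n ⬝ᵥ α = 0 := by
    rw [dotProduct_comm, hn, dotProduct_mulVec_comm_of_symm hA, hAa, dotProduct_zero]
  have nb : n ⬝ᵥ β = s := by
    rw [dotProduct_comm, hn, dotProduct_mulVec_comm_of_symm hA, dotProduct_comm]
  have ua : u ⬝ᵥ α = 0 := by
    rw [dotProduct_comm, hu, dotProduct_mulVec_comm_of_symm hA, hAa, dotProduct_zero]
  have vb : v ⬝ᵥ β = 0 := by
    rw [dotProduct_comm, hv, dotProduct_mulVec_comm_of_symm hB, hBb, dotProduct_zero]
  have am : a ⬝ᵥ H *ᵥ m = s := by rw [dotProduct_mulVec_comm_of_symm hH, ma]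
  have bm : b ⬝ᵥ H *ᵥ m = 0 := by rw [dotProduct_mulVec_comm_of_symm hH, mb]
  have an : a ⬝ᵥ H *ᵥ n = 0 := by rw [dotProduct_mulVec_comm_of_symm hH, na]
  have bn : b ⬝ᵥ H *ᵥ n = s := by rw [dotProduct_mulVec_comm_of_symm hH, nb]
  have trBHA : (H * (B * H * A)).trace = d := by
    rw [← trace_transpose]
    rw [transpose_mul, transpose_mul, transpose_mul, hA, hB, hH, trace_mul_comm,
      ← Matrix.mul_assoc A H B]
  have hMAB : Mop H A B (vecOf H b) = -m := by
    rw [Mop_eq_mulVec hH hA hB, vecOf_eq_neg_mulVec]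
    simp only [mulVec_neg, hm, hu, hβ]
  have hMBA : Mop H B A (vecOf H a) = -n := by
    rw [Mop_eq_mulVec hH hB hA, vecOf_eq_neg_mulVec]
    simp only [mulVec_neg, hn, hv, hα]
  have hJ : Jcov H A B a b ε =
      (-(1 / 8) * d) • (a + ε • b) + (1 / 4 : ℝ) • n + (ε / 4) • m := by
    ext i
    simp only [Jcov, hMAB, hMBA, dotg_eq_trace hH hB, ← hd, Pi.add_apply, Pi.smul_apply,
      Pi.neg_apply, smul_eq_mul]
    ring
  refine (congrArg (fun S => Pol H S (a + ε • b)) (Icor_eq_matrix hA hB hH a b ε)).trans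
    ((Pol_eq_mulVec_sub_trace hH _ _).trans ?_)
  rw [hJ, hMAB, hMBA,
    dotg_eq_trace hH hB, ← hd, hBil_eq_dotProduct, app2_eq_dotProduct, app2_eq_dotProduct,
    app1_eq_mulVec, app1_eq_mulVec, vecOf_eq_neg_mulVec, vecOf_eq_neg_mulVec]
  simp only [← hα, ← hβ, mulVec_neg, ← hu, ← hv, ← hk, mul_add, trace_add, Matrix.mul_smul,
    trace_smul, trace_mul_symOuter hH, add_mulVec, smul_mulVec, symOuter_mulVec, mulVec_add,
    mulVec_smul, add_dotProduct, dotProduct_add, smul_dotProduct, dotProduct_smul,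
    neg_dotProduct, dotProduct_neg, ← mulVec_mulVec, ← hn, ← hm, trA, trB, hAa, hBb, ha, hb,
    kba, ma, mb, na, nb, ua, vb, am, bm, an, bn, trBHA, ← hd, ← hs, mulVec_zero,
    smul_eq_mul]
  rw [dotProduct_comm α v, dotProduct_comm β u]
  ext i
  simp only [Pi.add_apply, Pi.sub_apply, Pi.smul_apply, Pi.neg_apply, Pi.zero_apply, smul_eq_mul]
  rcases sq_eq_one_iff.mp hε with rfl | rfl <;> ring

end

/-- the transparency identity `Pol(𝓘^{(0,ε)}, ℓ_A + ε ℓ_B) = 0`. -/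
theorem statement5
    (g h : Fin 4 → Fin 4 → ℝ)
    (hg_symm : ∀ α β, g α β = g β α)
    (h_inv₁ : ∀ α β, (∑ σ, g α σ * h σ β) = if α = β then (1 : ℝ) else 0)
    (h_inv₂ : ∀ α β, (∑ σ, h α σ * g σ β) = if α = β then (1 : ℝ) else 0)
    (ℓA ℓB : Fin 4 → ℝ)
    (hnullA : hBil h ℓA ℓA = 0) (hnullB : hBil h ℓB ℓB = 0)
    (FA FB : Fin 4 → Fin 4 → ℝ)
    (hFA_symm : ∀ α β, FA α β = FA β α) (hFB_symm : ∀ α β, FB α β = FB β α)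
    (hFA_tr : (∑ μ, ∑ ν, h μ ν * FA μ ν) = 0)
    (hFB_tr : (∑ μ, ∑ ν, h μ ν * FB μ ν) = 0)
    (hFA_trans : ∀ μ, (∑ ν, FA μ ν * vecOf h ℓA ν) = 0)
    (hFB_trans : ∀ μ, (∑ ν, FB μ ν * vecOf h ℓB ν) = 0)
    (ε : ℝ) (hε : ε = 1 ∨ ε = -1) :
    ∀ α, Pol h (Icor h FA FB ℓA ℓB ε) (fun β => ℓA β + ε * ℓB β) α = 0 := by
  have hH : (Matrix.of h).transpose = Matrix.of h :=
    transpose_eq_self_of_mul_eq_one (G := Matrix.of g)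
      (Matrix.ext fun α β => hg_symm β α)
      (Matrix.ext fun α β => by
        rw [Matrix.mul_apply, Matrix.one_apply]
        exact h_inv₁ α β)
  have hA : (Matrix.of FA).transpose = Matrix.of FA := Matrix.ext fun α β => hFA_symm β α
  have hB : (Matrix.of FB).transpose = Matrix.of FB := Matrix.ext fun α β => hFB_symm β α
  have trace_eq (F : Matrix (Fin 4) (Fin 4) ℝ) (hF : F.transpose = F) :
      (Matrix.of h * F).trace = ∑ μ, ∑ ν, h μ ν * F μ ν := by
    simp only [Matrix.trace, Matrix.diag, Matrix.mul_apply]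
    refine Finset.sum_congr rfl fun μ _ => Finset.sum_congr rfl fun ν _ => ?_
    rw [← congrFun (congrFun hF μ) ν, Matrix.transpose_apply, Matrix.of_apply]
  have transverse (F : Matrix (Fin 4) (Fin 4) ℝ) (l : Fin 4 → ℝ)
      (hF : ∀ μ, (∑ ν, F μ ν * vecOf h l ν) = 0) :
      F.mulVec ((Matrix.of h).mulVec l) = 0 := by
    rw [← neg_eq_zero, ← Matrix.mulVec_neg]
    exact funext hF
  exact congrFun (Pol_Icor_eq_zero hA hB hH
    ((hBil_eq_dotProduct _ _ _).symm.trans hnullA) ((hBil_eq_dotProduct _ _ _).symm.trans hnullB)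
    ((trace_eq _ hA).trans hFA_tr) ((trace_eq _ hB).trans hFB_tr)
    (transverse _ _ hFA_trans) (transverse _ _ hFB_trans) (sq_eq_one_iff.mpr hε))
end

section
/- Let U ⊆ ℝ³ be open and let g (positive definite symmetric 3×3), k₀ (symmetric 3×3), F̄ (symmetric 3×3), u (scalar) and D (covector) be smooth fields on U, with h := g⁻¹ pointwise. Assume ∇u ≠ 0 on U and set ω_i := ∂_i u, |∇u| := √(h^{ij} ω_i ω_j), N^i := h^{ij} ω_j / |∇u|, N♭_i := ω_i / |∇u|. Assume that identically on U: h^{ij} F̄_{ij} = 0 (trace-free) and F̄_{ij} h^{jk} ω_k = 0 for all i (transversality). Define on U: φ̂ := (1/(8|∇u|²)) F̄_{ij} ( −h^{ia} ∂_a (h^{jb} ∂_b u) + |∇u| h^{ia} h^{jb} (k₀)_{ab} + (1/2) h^{lm} ∂_m u · ∂_l h^{ij} ); Q_l := −F̄_{lk} h^{ki} ( D_i + N^m (k₀)_{mi} ) + h^{ij} ∂_i F̄_{lj} + (1/2) F̄_{ij} ∂_l h^{ij} for l = 1,2,3, and Q₀ := F̄_{ij} h^{ia} h^{jb} (k₀)_{ab};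 Q_N := N^l Q_l and Q_L := |∇u| (Q₀ − Q_N). Define the symmetric 4×4 field F⁽²¹⁾ by F⁽²¹⁾_{ij} := 4 φ̂ g_{ij}, F⁽²¹⁾_{00} := 0, F⁽²¹⁾_{0i} = F⁽²¹⁾_{i0} := (2φ̂ − Q_L/(2|∇u|²)) N♭_i + (Q_i − Q_N N♭_i)/|∇u|. Let ℓ be the 4-covector (|∇u|, ω₁, ω₂, ω₃) and Q the 4-covector (Q₀, Q₁, Q₂, Q₃). Then identically on U the covector V := Pol_𝐠(F⁽²¹⁾, ℓ) + Q vanishes: 𝐡^{μν} F⁽²¹⁾_{αμ} ℓ_ν − (1/2)(𝐡^{μν} F⁽²¹⁾_{μν}) ℓ_α + Q_α = 0 for every α ∈ {0,1,2,3}. (This is the polarization condition V^{(2,1)} = 0 for the first-harmonic corrector on the initial hypersurface.) -/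
open BigOperators

noncomputable section

/-- The spatial slice `ℝ³`. -/
abbrev Spc : Type := Fin 3 → ℝ

/-- The partial derivative `∂_i f (x) := (fderiv ℝ f x)(e_i)`. -/
def pd (i : Fin 3) (f : Spc → ℝ) (x : Spc) : ℝ := fderiv ℝ f x (Pi.single i 1)

/-- The block 4×4 matrix with `00`-entry `a`, `0i`- and `i0`-entries `b i`, and
spatial block `m`. -/
def blk (a : ℝ) (b : Fin 3 → ℝ) (m : Fin 3 → Fin 3 → ℝ) : Fin 4 → Fin 4 → ℝ :=
  fun μ ν =>
    if hμ : μ = 0 then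
      (if hν : ν = 0 then a else b (ν.pred hν))
    else
      (if hν : ν = 0 then b (μ.pred hμ) else m (μ.pred hμ) (ν.pred hν))

/-- The 4-covector with time component `a` and spatial components `ω`. -/
def cov4 (a : ℝ) (ω : Fin 3 → ℝ) : Fin 4 → ℝ :=
  fun μ => if hμ : μ = 0 then a else ω (μ.pred hμ)

/-- `|∇u| := √(h^{ij} ∂_i u ∂_j u)`. -/
def nr (h : Fin 3 → Fin 3 → Spc → ℝ) (u : Spc → ℝ) (x : Spc) : ℝ :=
  Real.sqrt (∑ i, ∑ j, h i j x * pd i u x * pd j u x)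

/-- `N^i := h^{ij} ∂_j u / |∇u|`. -/
def Nup (h : Fin 3 → Fin 3 → Spc → ℝ) (u : Spc → ℝ) (i : Fin 3) (x : Spc) : ℝ :=
  (∑ j, h i j x * pd j u x) / nr h u x

/-- `N♭_i := ∂_i u / |∇u|`. -/
def Nlow (h : Fin 3 → Fin 3 → Spc → ℝ) (u : Spc → ℝ) (i : Fin 3) (x : Spc) : ℝ :=
  pd i u x / nr h u x

/-- The scalar `φ̂ = φ̂^{(2,1)}`. -/
def phiHat (h k₀ Fb : Fin 3 → Fin 3 → Spc → ℝ) (u : Spc → ℝ) (x : Spc) : ℝ :=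
  (1 / (8 * (nr h u x) ^ 2)) *
    ∑ i, ∑ j, Fb i j x *
      ( -(∑ a, h i a x * pd a (fun y => ∑ b, h j b y * pd b u y) x)
        + nr h u x * (∑ a, ∑ b, h i a x * h j b x * k₀ a b x)
        + (1 / 2) * (∑ l, ∑ m, h l m x * pd m u x * pd l (h i j) x) )

/-- The spatial components `Q_l` of the covector `Q = Q^{(0)}`. -/
def Qc (h k₀ Fb : Fin 3 → Fin 3 → Spc → ℝ) (u : Spc → ℝ) (D : Fin 3 → Spc → ℝ)
    (l : Fin 3) (x : Spc) : ℝ :=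
  -(∑ k, ∑ i, Fb l k x * h k i x * (D i x + ∑ m, Nup h u m x * k₀ m i x))
  + (∑ i, ∑ j, h i j x * pd i (Fb l j) x)
  + (1 / 2) * (∑ i, ∑ j, Fb i j x * pd l (h i j) x)

/-- The time component `Q₀ := F̄_{ij} h^{ia} h^{jb} (k₀)_{ab}`. -/
def Q0 (h k₀ Fb : Fin 3 → Fin 3 → Spc → ℝ) (x : Spc) : ℝ :=
  ∑ i, ∑ j, ∑ a, ∑ b, Fb i j x * h i a x * h j b x * k₀ a b x

/-- `Q_N := N^l Q_l`. -/
def QN (h k₀ Fb : Fin 3 → Fin 3 → Spc → ℝ) (u : Spc → ℝ) (D : Fin 3 → Spc → ℝ)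
    (x : Spc) : ℝ :=
  ∑ l, Nup h u l x * Qc h k₀ Fb u D l x

/-- `Q_L := |∇u| (Q₀ − Q_N)`. -/
def QL (h k₀ Fb : Fin 3 → Fin 3 → Spc → ℝ) (u : Spc → ℝ) (D : Fin 3 → Spc → ℝ)
    (x : Spc) : ℝ :=
  nr h u x * (Q0 h k₀ Fb x - QN h k₀ Fb u D x)

/-- The symmetric 4×4 corrector `F^{(2,1)}` on the initial hypersurface. -/
def F21 (g h k₀ Fb : Fin 3 → Fin 3 → Spc → ℝ) (u : Spc → ℝ) (D : Fin 3 → Spc → ℝ)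
    (x : Spc) : Fin 4 → Fin 4 → ℝ :=
  blk 0
    (fun i => (2 * phiHat h k₀ Fb u x - QL h k₀ Fb u D x / (2 * (nr h u x) ^ 2))
        * Nlow h u i x
      + (Qc h k₀ Fb u D i x - QN h k₀ Fb u D x * Nlow h u i x) / nr h u x)
    (fun i j => 4 * phiHat h k₀ Fb u x * g i j x)

end

section InverseMetric

variable {ι : Type*} [Fintype ι] [DecidableEq ι] {G H : ι → ι → ℝ}

/-- A right inverse of a symmetric matrix is symmetric. -/
lemma inverse_symm (hG : ∀ i j, G i j = G j i)
    (hGH : ∀ i j, (∑ k, G i k * H k j) = if i = j then (1 : ℝ) else 0) (i j : ι) :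
    H i j = H j i := by
  have hmul : Matrix.of G * Matrix.of H = 1 := by
    ext a b
    simpa [Matrix.mul_apply, Matrix.one_apply] using hGH a b
  have hGT : (Matrix.of G).transpose = Matrix.of G := by
    ext a b
    exact hG b a
  have hmulT : (Matrix.of H).transpose * Matrix.of G = 1 := by
    rw [← hGT, ← Matrix.transpose_mul, hmul, Matrix.transpose_one]
  have hHT : (Matrix.of H).transpose = Matrix.of H := left_inv_eq_right_inv hmulT hmul
  simpa using congrFun (congrFun hHT j) i

/-- The inverse of a positive definite matrix is positive definite. -/
lemma inverse_pos
    (hpos : ∀ ξ : ι → ℝ, ξ ≠ 0 → 0 < ∑ i, ∑ j, G i j * ξ i * ξ j)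
    (hGH : ∀ i j, (∑ k, G i k * H k j) = if i = j then (1 : ℝ) else 0)
    {ω : ι → ℝ} (hω : ω ≠ 0) : 0 < ∑ i, ∑ j, H i j * ω i * ω j := by
  set ξ : ι → ℝ := fun i => ∑ j, H i j * ω j with hξ
  have hlower : ∀ i, ∑ j, G i j * ξ j = ω i := by
    intro i
    simp only [hξ, Finset.mul_sum]
    rw [Finset.sum_comm]
    simp only [← mul_assoc, ← Finset.sum_mul, hGH, ite_mul, one_mul, zero_mul,
      Finset.sum_ite_eq, Finset.mem_univ, if_true]
  have hξ0 : ξ ≠ 0 := by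
    intro h0
    refine hω (funext fun i => ?_)
    simp [← hlower i, h0]
  convert hpos ξ hξ0 using 1
  refine Finset.sum_congr rfl fun i _ => ?_
  calc ∑ j, H i j * ω i * ω j = ω i * ξ i := by
        simp only [hξ, Finset.mul_sum]
        exact Finset.sum_congr rfl fun j _ => by ring
    _ = ∑ j, G i j * ξ i * ξ j := by
        rw [← hlower i, Finset.sum_mul]
        exact Finset.sum_congr rfl fun j _ => by ring

end InverseMetric

/-- The trace of `g` with respect to its own inverse is the dimension. -/
lemma inverse_trace {G H : Fin 3 → Fin 3 → ℝ} (hG : ∀ i j, G i j = G j i)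
    (hHG : ∀ i j, (∑ k, H i k * G k j) = if i = j then (1 : ℝ) else 0) :
    ∑ i, ∑ j, H i j * G i j = 3 := by
  have : ∀ i, ∑ j, H i j * G i j = 1 := fun i => by
    simpa [hG i] using hHG i i
  simp [this]

/-- The polarization condition for a tensor of the shape of the corrector reduces to
one scalar equation relating `φ` to the null components of `Q`. -/
lemma polarization_eq_zero {G H : Fin 3 → Fin 3 → ℝ} {ω Q : Fin 3 → ℝ} {n φ q₀ qN : ℝ}
    (hn : n ≠ 0) (hnorm : ∑ i, ∑ j, H i j * ω i * ω j = n ^ 2)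
    (htr : ∑ i, ∑ j, H i j * G i j = 3)
    (hlower : ∀ i, ∑ j, (∑ k, H j k * ω k) * G i j = ω i)
    (hqN : n * qN = ∑ l, (∑ j, H l j * ω j) * Q l)
    (hφ : 8 * φ * n = q₀ + qN) (b : Fin 3 → ℝ)
    (hb : ∀ i, b i = (2 * φ - n * (q₀ - qN) / (2 * n ^ 2)) * (ω i / n)
      + (Q i - qN * (ω i / n)) / n) (α : Fin 4) :
    (∑ μ, ∑ ν, blk (-1) (fun _ => 0) H μ ν
        * blk 0 b (fun i j => 4 * φ * G i j) α μ * cov4 n ω ν)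
      - (1 / 2) * (∑ μ, ∑ ν, blk (-1) (fun _ => 0) H μ ν
        * blk 0 b (fun i j => 4 * φ * G i j) μ ν) * cov4 n ω α
      + cov4 q₀ Q α = 0 := by
  have hb' : ∀ i, n * b i = Q i + (2 * φ - (q₀ + qN) / (2 * n)) * ω i := by
    intro i
    rw [hb]
    field_simp
    ring
  have htrace : ∑ μ, ∑ ν, blk (-1) (fun _ => 0) H μ ν
      * blk 0 b (fun i j => 4 * φ * G i j) μ ν = 12 * φ := by
    have : ∑ i, ∑ j, H i j * (4 * φ * G i j) = 4 * φ * ∑ i, ∑ j, H i j * G i j := by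
      simp only [Finset.mul_sum]
      exact Finset.sum_congr rfl fun i _ => Finset.sum_congr rfl fun j _ => by ring
    simp only [Fin.sum_univ_succ (n := 3), blk, Fin.succ_ne_zero, dite_true, dite_false,
      Fin.pred_succ, mul_zero, zero_mul, Finset.sum_const_zero, zero_add, add_zero, this, htr]
    ring
  have hcoef : 2 * φ - (q₀ + qN) / (2 * n) = -(2 * φ) := by
    rw [← hφ]
    field_simp
    ring
  rw [htrace]
  refine Fin.cases ?_ (fun i => ?_) α
  · have hcontr : n * ∑ i, ∑ j, H i j * b i * ω j = n * (qN - 2 * φ * n) := by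
      calc n * ∑ i, ∑ j, H i j * b i * ω j
          = ∑ i, ∑ j, H i j * (n * b i) * ω j := by
            simp only [Finset.mul_sum]
            exact Finset.sum_congr rfl fun i _ => Finset.sum_congr rfl fun j _ => by ring
        _ = ∑ l, (∑ j, H l j * ω j) * Q l - 2 * φ * ∑ i, ∑ j, H i j * ω i * ω j := by
            simp only [hb', hcoef, Finset.mul_sum, Finset.sum_mul, ← Finset.sum_sub_distrib]
            exact Finset.sum_congr rfl fun i _ => Finset.sum_congr rfl fun j _ => by ring
        _ = n * (qN - 2 * φ * n) := by
            rw [← hqN, hnorm]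
            ring
    have hcontr' := mul_left_cancel₀ hn hcontr
    simp only [Fin.sum_univ_succ (n := 3), blk, cov4, Fin.succ_ne_zero, dite_true, dite_false,
      Fin.pred_succ, mul_zero, zero_mul, Finset.sum_const_zero, zero_add, add_zero, hcontr']
    linear_combination -hφ
  · have hcontr : ∑ j, ∑ k, H j k * (4 * φ * G i j) * ω k = 4 * φ * ω i := by
      rw [← hlower i]
      simp only [Finset.mul_sum, Finset.sum_mul]
      exact Finset.sum_congr rfl fun i _ => Finset.sum_congr rfl fun j _ => by ring
    simp only [Fin.sum_univ_succ (n := 3), blk, cov4, Fin.succ_ne_zero, dite_true, dite_false,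
      Fin.pred_succ, zero_mul, Finset.sum_const_zero, zero_add, add_zero, hcontr]
    linear_combination -hb' i - ω i * hcoef

/-- Product rule for the partial derivatives of a vanishing contraction. -/
lemma sum_pd_mul_eq_zero {U : Set Spc} (hU : IsOpen U) {f w : Fin 3 → Spc → ℝ} {x : Spc}
    (hx : x ∈ U) (hf : ∀ l, DifferentiableAt ℝ (f l) x) (hw : ∀ l, DifferentiableAt ℝ (w l) x)
    (h0 : ∀ y ∈ U, ∑ l, f l y * w l y = 0) (a : Fin 3) :
    ∑ l, (f l x * pd a (w l) x + pd a (f l) x * w l x) = 0 := by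
  have hfd : HasFDerivAt (fun y => ∑ l, f l y * w l y)
      (∑ l, (f l x • fderiv ℝ (w l) x + w l x • fderiv ℝ (f l) x)) x :=
    HasFDerivAt.fun_sum fun l _ => (hf l).hasFDerivAt.mul (hw l).hasFDerivAt
  have hev : (fun y => ∑ l, f l y * w l y) =ᶠ[nhds x] fun _ => (0 : ℝ) :=
    Filter.eventually_of_mem (hU.mem_nhds hx) h0
  have hz := (hfd.congr_of_eventuallyEq hev.symm).unique (hasFDerivAt_const (0 : ℝ) x)
  simpa [pd, mul_comm] using congrArg (fun L : Spc →L[ℝ] ℝ => L (Pi.single a 1)) hz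

/-- Partial derivatives of a smooth function are differentiable. -/
lemma differentiableAt_pd {U : Set Spc} (hU : IsOpen U) {f : Spc → ℝ}
    (hf : ContDiffOn ℝ (⊤ : ℕ∞) f U) {x : Spc} (hx : x ∈ U) (i : Fin 3) :
    DifferentiableAt ℝ (pd i f) x := by
  have hfx : ContDiffAt ℝ (⊤ : ℕ∞) f x := hf.contDiffAt (hU.mem_nhds hx)
  have hd : DifferentiableAt ℝ (fderiv ℝ f) x :=
    (hfx.fderiv_right (m := 1) (by norm_cast)).differentiableAt (by norm_num)
  exact hd.clm_apply (differentiableAt_const _)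

/-- the polarization condition `V^{(2,1)} = 0` for the first-harmonic
corrector on the initial hypersurface: `Pol_𝐠(F^{(2,1)}, ℓ) + Q = 0` identically on `U`. -/
theorem statement11
    (U : Set Spc) (hU : IsOpen U)
    (g h k₀ Fb : Fin 3 → Fin 3 → Spc → ℝ) (u : Spc → ℝ) (D : Fin 3 → Spc → ℝ)
    (hg_smooth : ∀ i j, ContDiffOn ℝ (⊤ : ℕ∞) (g i j) U)
    (hh_smooth : ∀ i j, ContDiffOn ℝ (⊤ : ℕ∞) (h i j) U)
    (hk_smooth : ∀ i j, ContDiffOn ℝ (⊤ : ℕ∞) (k₀ i j) U)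
    (hF_smooth : ∀ i j, ContDiffOn ℝ (⊤ : ℕ∞) (Fb i j) U)
    (hu_smooth : ContDiffOn ℝ (⊤ : ℕ∞) u U)
    (hD_smooth : ∀ i, ContDiffOn ℝ (⊤ : ℕ∞) (D i) U)
    (hg_symm : ∀ x ∈ U, ∀ i j, g i j x = g j i x)
    (hg_pos : ∀ x ∈ U, ∀ ξ : Fin 3 → ℝ, ξ ≠ 0 → 0 < ∑ i, ∑ j, g i j x * ξ i * ξ j)
    (hk_symm : ∀ x ∈ U, ∀ i j, k₀ i j x = k₀ j i x)
    (hF_symm : ∀ x ∈ U, ∀ i j, Fb i j x = Fb j i x)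
    (h_inv₁ : ∀ x ∈ U, ∀ i j, (∑ k, g i k x * h k j x) = if i = j then (1 : ℝ) else 0)
    (h_inv₂ : ∀ x ∈ U, ∀ i j, (∑ k, h i k x * g k j x) = if i = j then (1 : ℝ) else 0)
    (hgrad : ∀ x ∈ U, (fun i => pd i u x) ≠ 0)
    (hF_tr : ∀ x ∈ U, (∑ i, ∑ j, h i j x * Fb i j x) = 0)
    (hF_trans : ∀ x ∈ U, ∀ i, (∑ j, ∑ k, Fb i j x * h j k x * pd k u x) = 0) :
    ∀ x ∈ U, ∀ α,
      (∑ μ, ∑ ν, blk (-1) (fun _ => 0) (fun i j => h i j x) μ ν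
          * F21 g h k₀ Fb u D x α μ * cov4 (nr h u x) (fun i => pd i u x) ν)
      - (1 / 2) * (∑ μ, ∑ ν, blk (-1) (fun _ => 0) (fun i j => h i j x) μ ν
          * F21 g h k₀ Fb u D x μ ν) * cov4 (nr h u x) (fun i => pd i u x) α
      + cov4 (Q0 h k₀ Fb x) (fun l => Qc h k₀ Fb u D l x) α = 0 := by
  intro x hx
  have hhs : ∀ i j, h i j x = h j i x := inverse_symm (hg_symm x hx) (h_inv₁ x hx)
  have hpos : 0 < ∑ i, ∑ j, h i j x * pd i u x * pd j u x :=
    inverse_pos (hg_pos x hx) (h_inv₁ x hx) (hgrad x hx)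
  have hn : nr h u x ≠ 0 := (Real.sqrt_pos.2 hpos).ne'
  have hnorm : ∑ i, ∑ j, h i j x * pd i u x * pd j u x = nr h u x ^ 2 :=
    (Real.sq_sqrt hpos.le).symm
  set w : Fin 3 → Spc → ℝ := fun l y => ∑ m, h l m y * pd m u y with hw
  have hlower : ∀ i, ∑ j, w j x * g i j x = pd i u x := by
    intro i
    simp only [hw, Finset.sum_mul]
    rw [Finset.sum_comm]
    calc ∑ k, ∑ j, h j k x * pd k u x * g i j x
        = ∑ k, (∑ j, g i j x * h j k x) * pd k u x := by
          simp only [Finset.sum_mul]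
          exact Finset.sum_congr rfl fun k _ => Finset.sum_congr rfl fun j _ => by ring
      _ = pd i u x := by simp [h_inv₁ x hx]
  have hqN : nr h u x * QN h k₀ Fb u D x = ∑ l, w l x * Qc h k₀ Fb u D l x := by
    simp only [QN, Nup, Finset.mul_sum, hw]
    refine Finset.sum_congr rfl fun l _ => ?_
    field_simp
  have hFw : ∀ y ∈ U, ∀ i, ∑ l, Fb i l y * w l y = 0 := by
    intro y hy i
    rw [← hF_trans y hy i]
    simp only [hw, Finset.mul_sum, mul_assoc]
  have hFw' : ∀ i, ∑ l, w l x * Fb l i x = 0 := by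
    intro i
    rw [← hFw x hx i]
    exact Finset.sum_congr rfl fun l _ => by rw [hF_symm x hx l i, mul_comm]
  have hdF : ∀ i j, DifferentiableAt ℝ (Fb i j) x := fun i j =>
    ((hF_smooth i j).contDiffAt (hU.mem_nhds hx)).differentiableAt (by simp)
  have hdw : ∀ l, DifferentiableAt ℝ (w l) x := fun l =>
    DifferentiableAt.fun_sum fun m _ =>
      (((hh_smooth l m).contDiffAt (hU.mem_nhds hx)).differentiableAt (by simp)).mul
        (differentiableAt_pd hU hu_smooth hx m)
  have hFsymm_pd : ∀ a i j, pd a (Fb i j) x = pd a (Fb j i) x := by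
    intro a i j
    have hev : Fb i j =ᶠ[nhds x] Fb j i :=
      Filter.eventually_of_mem (hU.mem_nhds hx) fun y hy => hF_symm y hy i j
    simp only [pd, hev.fderiv_eq]
  have hleib : ∀ i a, ∑ l, (Fb i l x * pd a (w l) x + pd a (Fb i l) x * w l x) = 0 :=
    fun i a => sum_pd_mul_eq_zero hU hx (hdF i) hdw (fun y hy => hFw y hy i) a
  have hdiv : ∑ l, w l x * (∑ i, ∑ j, h i j x * pd i (Fb l j) x)
      = -∑ i, ∑ j, Fb i j x * ∑ a, h i a x * pd a (w j) x := by
    rw [eq_neg_iff_add_eq_zero]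
    calc _ = ∑ i, ∑ a, h i a x
          * ∑ l, (Fb i l x * pd a (w l) x + pd a (Fb i l) x * w l x) := by
          simp only [Fin.sum_univ_three, hFsymm_pd _ 1 0, hFsymm_pd _ 2 0, hFsymm_pd _ 2 1,
            hhs 1 0, hhs 2 0, hhs 2 1]
          ring
      _ = 0 := by simp [hleib]
  have hfirst : ∑ l, w l x
      * ∑ k, ∑ i, Fb l k x * h k i x * (D i x + ∑ m, Nup h u m x * k₀ m i x) = 0 := by
    have hswap : ∀ c : Fin 3 → Fin 3 → ℝ, ∑ l, w l x * ∑ k, ∑ i, Fb l k x * h k i x * c k i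
        = ∑ k, (∑ l, w l x * Fb l k x) * ∑ i, h k i x * c k i := fun c => by
      simp only [Fin.sum_univ_three]
      ring
    refine (hswap fun _ i => D i x + ∑ m, Nup h u m x * k₀ m i x).trans ?_
    simp only [hFw', zero_mul, Finset.sum_const_zero]
  have hmetric : ∑ i, ∑ j, Fb i j x * ∑ l, ∑ m, h l m x * pd m u x * pd l (h i j) x
      = ∑ l, w l x * ∑ i, ∑ j, Fb i j x * pd l (h i j) x := by
    simp only [hw, Fin.sum_univ_three]
    ring
  have hQ0 : ∑ i, ∑ j, Fb i j x * ∑ a, ∑ b, h i a x * h j b x * k₀ a b x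
      = Q0 h k₀ Fb x := by
    simp only [Q0, Finset.mul_sum, mul_assoc]
  have hQw : ∑ l, w l x * Qc h k₀ Fb u D l x
      = -(∑ i, ∑ j, Fb i j x * ∑ a, h i a x * pd a (w j) x)
        + 1 / 2 * ∑ l, w l x * ∑ i, ∑ j, Fb i j x * pd l (h i j) x := by
    have hsplit : ∑ l, w l x * Qc h k₀ Fb u D l x
        = -(∑ l, w l x
            * ∑ k, ∑ i, Fb l k x * h k i x * (D i x + ∑ m, Nup h u m x * k₀ m i x))
          + (∑ l, w l x * ∑ i, ∑ j, h i j x * pd i (Fb l j) x)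
          + 1 / 2 * ∑ l, w l x * ∑ i, ∑ j, Fb i j x * pd l (h i j) x := by
      rw [Finset.mul_sum, ← Finset.sum_neg_distrib, ← Finset.sum_add_distrib,
        ← Finset.sum_add_distrib]
      exact Finset.sum_congr rfl fun l _ => by rw [Qc]; ring
    rw [hsplit, hfirst, hdiv]
    ring
  have hphi : 8 * phiHat h k₀ Fb u x * nr h u x ^ 2
      = nr h u x * Q0 h k₀ Fb x + ∑ l, w l x * Qc h k₀ Fb u D l x := by
    have hsplit : 8 * phiHat h k₀ Fb u x * nr h u x ^ 2
        = -(∑ i, ∑ j, Fb i j x * ∑ a, h i a x * pd a (w j) x)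
          + nr h u x * (∑ i, ∑ j, Fb i j x * ∑ a, ∑ b, h i a x * h j b x * k₀ a b x)
          + 1 / 2 * ∑ i, ∑ j, Fb i j x
            * ∑ l, ∑ m, h l m x * pd m u x * pd l (h i j) x := by
      have hcancel : ∀ s : ℝ,
          8 * (1 / (8 * nr h u x ^ 2) * s) * nr h u x ^ 2 = s := fun s => by
        field_simp
      have hlin : ∀ A B C : Fin 3 → Fin 3 → ℝ,
          ∑ i, ∑ j, Fb i j x * (-A i j + nr h u x * B i j + 1 / 2 * C i j)
            = -(∑ i, ∑ j, Fb i j x * A i j) + nr h u x * (∑ i, ∑ j, Fb i j x * B i j)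
              + 1 / 2 * ∑ i, ∑ j, Fb i j x * C i j := fun A B C => by
        simp only [Fin.sum_univ_three]
        ring
      rw [phiHat, hcancel]
      exact hlin _ _ _
    rw [hsplit, hQ0, hmetric, hQw]
    ring
  have hφ : 8 * phiHat h k₀ Fb u x * nr h u x = Q0 h k₀ Fb x + QN h k₀ Fb u D x := by
    refine mul_right_cancel₀ hn ?_
    linear_combination hphi - hqN
  exact polarization_eq_zero hn hnorm (inverse_trace (hg_symm x hx) (h_inv₂ x hx))
    hlower hqN hφ _ (fun i => rfl)
end

section
/- Let g be a positive definite symmetric real 3×3 matrix with inverse h, let ω_A, ω_B ∈ ℝ³ be nonzero covectors, fix ε ∈ {+1, −1}, and let F̄_A, F̄_B be symmetric 3×3 matrices with h^{ij} (F̄_A)_{ij} = 0 and (F̄_A)_{ij} h^{jk} (ω_A)_k = 0 for all i, and likewise for (F̄_B, ω_B). Assume ω_A + ε ω_B ≠ 0 and h^{ij}(ω_A)_i (ω_B)_j ≠ |ω_A| |ω_B| (so 𝐡(w,w) ≠ 0). With ℓ_A := (|ω_A|, ω_A), ℓ_B := (|ω_B|, ω_B), the zero extensions F_A, F_B, and the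 symmetric 4×4 matrix 𝓘 := 𝓘^{(0,ε)}, set w := ℓ_A + ε ℓ_B, w̄_i := (ω_A + ε ω_B)_i, |∇w| := |ω_A + ε ω_B| and N_w^i := h^{ij} w̄_j / |∇w|. Define the covector X̂_i := −(1/8) |ω_B| h^{bc}(F̄_A)_{cd} h^{de}(ω_B)_e (F̄_B)_{bi} − (1/8) |ω_A| h^{bc}(F̄_B)_{cd} h^{de}(ω_A)_e (F̄_A)_{bi} + [ (1/8)( |ω_A| (ω_A)_i + |ω_B| (ω_B)_i ) + (1/16)( ε |ω_B| (ω_A)_i + ε |ω_A| (ω_B)_i ) ] |F̄_A·F̄_B|_h, the symmetric matrix κ_{ij} := [ −(|ω_A| + ε|ω_B|) 𝓘_{ij} + ( w̄_i 𝓘_{0j} + w̄_j 𝓘_{0i} ) ] / ( 2 𝐡(w,w) ) + (N_w ⊗̃ X̂)_{ij} / |∇w|, and F^{(2,ε)}_{αβ} := −𝓘_{αβ}/𝐡(w,w). Then for all i, j: P̄²_{N_w}(κ)_{ij} − (N_w ⊗̃ X̂)_{ij}/|∇w| = (1/2)[ (|ω_A| + ε|ω_B|) F^{(2,ε)}_{ij}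 − ( w̄_i F^{(2,ε)}_{0j} + w̄_j F^{(2,ε)}_{0i} ) ]; equivalently P̄²_{N_w}(κ) = κ. -/
open BigOperators

noncomputable section

/-- `|ω| := √(h^{ij} ω_i ω_j)` (3-dimensional). -/
def nrm3 (h : Fin 3 → Fin 3 → ℝ) (ω : Fin 3 → ℝ) : ℝ :=
  Real.sqrt (∑ i, ∑ j, h i j * ω i * ω j)

/-- `h^{ij} v_i w_j` (3-dimensional). -/
def dot3 (h : Fin 3 → Fin 3 → ℝ) (v w : Fin 3 → ℝ) : ℝ := ∑ i, ∑ j, h i j * v i * w j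

/-- The zero extension of a spatial matrix to a 4×4 matrix. -/
def ext0 (m : Fin 3 → Fin 3 → ℝ) : Fin 4 → Fin 4 → ℝ := blk 0 (fun _ => 0) m

/-- The inverse block Lorentzian metric `𝐡` built from `h`. -/
def bigH (h : Fin 3 → Fin 3 → ℝ) : Fin 4 → Fin 4 → ℝ := blk (-1) (fun _ => 0) h

/-- The null covector `ℓ := (|ω|, ω)`. -/
def ell (h : Fin 3 → Fin 3 → ℝ) (ω : Fin 3 → ℝ) : Fin 4 → ℝ := cov4 (nrm3 h ω) ω

/-- The spatial covector `w̄ := ω_A + ε ω_B`. -/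
def wbar (ωA ωB : Fin 3 → ℝ) (ε : ℝ) : Fin 3 → ℝ := fun i => ωA i + ε * ωB i

/-- The 4-covector `w := ℓ_A + ε ℓ_B`. -/
def wcov (h : Fin 3 → Fin 3 → ℝ) (ωA ωB : Fin 3 → ℝ) (ε : ℝ) : Fin 4 → ℝ :=
  fun μ => ell h ωA μ + ε * ell h ωB μ

/-- The tensor `𝓘^{(0,ε)}` built from `(g, h, ω_A, ω_B, F̄_A, F̄_B, ε)` after the 3+1 lift. -/
def I12 (h FbA FbB : Fin 3 → Fin 3 → ℝ) (ωA ωB : Fin 3 → ℝ) (ε : ℝ) :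
    Fin 4 → Fin 4 → ℝ :=
  Icor (bigH h) (ext0 FbA) (ext0 FbB) (ell h ωA) (ell h ωB) ε

/-- `𝐡(w,w)` for `w = ℓ_A + ε ℓ_B`. -/
def Hww (h : Fin 3 → Fin 3 → ℝ) (ωA ωB : Fin 3 → ℝ) (ε : ℝ) : ℝ :=
  hBil (bigH h) (wcov h ωA ωB ε) (wcov h ωA ωB ε)

/-- The scalar `φ̂^{(2,ε)}`. -/
def phi2 (h FbA FbB : Fin 3 → Fin 3 → ℝ) (ωA ωB : Fin 3 → ℝ) (ε : ℝ) : ℝ :=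
  ((∑ i, ∑ k, ∑ j, ∑ l, h i k * h j l * FbA i j * FbB k l)
      / (64 * (nrm3 h (wbar ωA ωB ε)) ^ 2))
    * (2 * (nrm3 h ωA) ^ 2 + 2 * (nrm3 h ωB) ^ 2
      + 3 * ε * dot3 h ωA ωB - ε * (nrm3 h ωA) * (nrm3 h ωB))
  - ε * (∑ i, ∑ b, ∑ c, ∑ j, ∑ d, ∑ e,
        FbA i b * h b c * ωB c * h i j * FbB j d * h d e * ωA e)
      / (32 * (nrm3 h (wbar ωA ωB ε)) ^ 2)

/-- The unit vector `N_w^i := h^{ij} w̄_j / |w̄|`. -/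
def Nw (h : Fin 3 → Fin 3 → ℝ) (ωA ωB : Fin 3 → ℝ) (ε : ℝ) : Fin 3 → ℝ :=
  fun i => (∑ j, h i j * wbar ωA ωB ε j) / nrm3 h (wbar ωA ωB ε)

/-- `γ_{ij} := −𝓘_{ij}/𝐡(w,w) − 4 φ̂^{(2,ε)} g_{ij}`. -/
def gam (g h FbA FbB : Fin 3 → Fin 3 → ℝ) (ωA ωB : Fin 3 → ℝ) (ε : ℝ) :
    Fin 3 → Fin 3 → ℝ :=
  fun i j => -(I12 h FbA FbB ωA ωB ε i.succ j.succ) / Hww h ωA ωB ε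
    - 4 * phi2 h FbA FbB ωA ωB ε * g i j

/-- `tr S := h^{ij} S_{ij}` (3-dimensional). -/
def trH (h S : Fin 3 → Fin 3 → ℝ) : ℝ := ∑ i, ∑ j, h i j * S i j

/-- `S_{NN} := N^i N^j S_{ij}`. -/
def quadN (N : Fin 3 → ℝ) (S : Fin 3 → Fin 3 → ℝ) : ℝ := ∑ i, ∑ j, N i * N j * S i j

/-- The operator `P̄¹_N(S)_{ij} := S_{ij} − (1/2)(tr S − S_{NN}) g_{ij}`. -/
def P1 (g h : Fin 3 → Fin 3 → ℝ) (N : Fin 3 → ℝ) (S : Fin 3 → Fin 3 → ℝ) :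
    Fin 3 → Fin 3 → ℝ :=
  fun i j => S i j - (1 / 2) * (trH h S - quadN N S) * g i j


/-- `N♭_i := g_{ij} N^j`. -/
def flatN (g : Fin 3 → Fin 3 → ℝ) (N : Fin 3 → ℝ) : Fin 3 → ℝ := fun i => ∑ j, g i j * N j

/-- The operator
`P̄²_N(S)_{ij} := S_{ij} + N♭_i (N♭_j tr S − S_{Nj}) + N♭_j (N♭_i tr S − S_{Ni})
  − (1/2)(tr S − S_{NN}) g_{ij}`. -/
def P2 (g h : Fin 3 → Fin 3 → ℝ) (N : Fin 3 → ℝ) (S : Fin 3 → Fin 3 → ℝ) :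
    Fin 3 → Fin 3 → ℝ :=
  fun i j => S i j
    + flatN g N i * (flatN g N j * trH h S - ∑ k, N k * S k j)
    + flatN g N j * (flatN g N i * trH h S - ∑ k, N k * S k i)
    - (1 / 2) * (trH h S - quadN N S) * g i j

/-- `(N ⊗̃ X)_{ij} := N♭_i X_j + N♭_j X_i − (1/2)(N^k X_k) g_{ij}`. -/
def tens (g : Fin 3 → Fin 3 → ℝ) (N X : Fin 3 → ℝ) : Fin 3 → Fin 3 → ℝ :=
  fun i j => flatN g N i * X j + flatN g N j * X i - (1 / 2) * (∑ k, N k * X k) * g i j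

/-- The covector `X̂` of STATEMENT 13. -/
def Xh (h FbA FbB : Fin 3 → Fin 3 → ℝ) (ωA ωB : Fin 3 → ℝ) (ε : ℝ) : Fin 3 → ℝ :=
  fun i =>
    -(1 / 8) * nrm3 h ωB
        * (∑ b, ∑ c, ∑ d, ∑ e, h b c * FbA c d * h d e * ωB e * FbB b i)
    - (1 / 8) * nrm3 h ωA
        * (∑ b, ∑ c, ∑ d, ∑ e, h b c * FbB c d * h d e * ωA e * FbA b i)
    + ((1 / 8) * (nrm3 h ωA * ωA i + nrm3 h ωB * ωB i)
      + (1 / 16) * (ε * nrm3 h ωB * ωA i + ε * nrm3 h ωA * ωB i))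
      * (∑ a, ∑ k, ∑ b, ∑ l, h a k * h b l * FbA a b * FbB k l)

/-- The symmetric matrix `κ` of STATEMENT 13. -/
def kap (g h FbA FbB : Fin 3 → Fin 3 → ℝ) (ωA ωB : Fin 3 → ℝ) (ε : ℝ) :
    Fin 3 → Fin 3 → ℝ :=
  fun i j =>
    (-(nrm3 h ωA + ε * nrm3 h ωB) * I12 h FbA FbB ωA ωB ε i.succ j.succ
      + (wbar ωA ωB ε i * I12 h FbA FbB ωA ωB ε 0 j.succ
        + wbar ωA ωB ε j * I12 h FbA FbB ωA ωB ε 0 i.succ))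
      / (2 * Hww h ωA ωB ε)
    + tens g (Nw h ωA ωB ε) (Xh h FbA FbB ωA ωB ε) i j / nrm3 h (wbar ωA ωB ε)

end

/-- The raised covector `v^i := h^{ij} v_j`. -/
def raise3 (h : Fin 3 → Fin 3 → ℝ) (v : Fin 3 → ℝ) : Fin 3 → ℝ := fun i => ∑ j, h i j * v j

/-- `P_{ij} X^j` (3-dimensional). -/
def mv3 (P : Fin 3 → Fin 3 → ℝ) (X : Fin 3 → ℝ) : Fin 3 → ℝ := fun i => ∑ j, P i j * X j

/-- `h^{ik} h^{jl} P_{ij} Q_{kl}` (3-dimensional). -/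
def pair3 (h P Q : Fin 3 → Fin 3 → ℝ) : ℝ :=
  ∑ a, ∑ k, ∑ b, ∑ l, h a k * h b l * P a b * Q k l

/-- The symmetrized product `h^{kl} (P_{ik} Q_{lj} + P_{jk} Q_{li})` (3-dimensional). -/
def symProd3 (h P Q : Fin 3 → Fin 3 → ℝ) : Fin 3 → Fin 3 → ℝ :=
  fun i j => ∑ k, ∑ l, h k l * (P i k * Q l j + P j k * Q l i)

section Components

variable (h P : Fin 3 → Fin 3 → ℝ) (ω : Fin 3 → ℝ) (i j : Fin 3) (μ : Fin 4)

@[simp] lemma bigH_zero_zero : bigH h 0 0 = -1 := by simp [bigH, blk]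

@[simp] lemma bigH_zero_succ : bigH h 0 j.succ = 0 := by simp [bigH, blk, Fin.succ_ne_zero]

@[simp] lemma bigH_succ_zero : bigH h i.succ 0 = 0 := by simp [bigH, blk, Fin.succ_ne_zero]

@[simp] lemma bigH_succ_succ : bigH h i.succ j.succ = h i j := by
  simp [bigH, blk, Fin.succ_ne_zero]

@[simp] lemma ext0_zero_left : ext0 P 0 μ = 0 := by simp [ext0, blk]

@[simp] lemma ext0_zero_right : ext0 P μ 0 = 0 := by simp [ext0, blk]

@[simp] lemma ext0_succ_succ : ext0 P i.succ j.succ = P i j := by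
  simp [ext0, blk, Fin.succ_ne_zero]

@[simp] lemma ell_zero : ell h ω 0 = nrm3 h ω := by simp [ell, cov4]

@[simp] lemma ell_succ : ell h ω i.succ = ω i := by simp [ell, cov4, Fin.succ_ne_zero]

end Components

lemma sum_four (f : Fin 4 → ℝ) : ∑ μ, f μ = f 0 + ∑ i : Fin 3, f i.succ :=
  Fin.sum_univ_succ f

section Lift

variable (h P Q : Fin 3 → Fin 3 → ℝ) (ω v : Fin 3 → ℝ)

lemma vecOf_ell_succ (i : Fin 3) : vecOf (bigH h) (ell h ω) i.succ = -raise3 h ω i := by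
  simp [vecOf, raise3, sum_four]

lemma hBil_ell : hBil (bigH h) (ell h ω) (ell h v) = dot3 h ω v - nrm3 h ω * nrm3 h v := by
  simp [hBil, dot3, sum_four]
  ring

lemma dotg_ext0 : dotg (bigH h) (ext0 P) (ext0 Q) = pair3 h P Q := by
  simp [dotg, pair3, sum_four]

lemma app1_ext0_zero (X : Fin 4 → ℝ) : app1 (ext0 P) X 0 = 0 := by
  simp [app1]

lemma app1_ext0_succ (i : Fin 3) :
    app1 (ext0 P) (vecOf (bigH h) (ell h ω)) i.succ = -mv3 P (raise3 h ω) i := by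
  simp [app1, mv3, sum_four, vecOf_ell_succ]

lemma app2_ext0 :
    app2 (ext0 P) (vecOf (bigH h) (ell h ω)) (vecOf (bigH h) (ell h ω))
      = ∑ i, raise3 h ω i * mv3 P (raise3 h ω) i := by
  simp only [app2, mv3, sum_four, vecOf_ell_succ, ext0_succ_succ, ext0_zero_left,
    ext0_zero_right, Fin.sum_univ_three]
  ring

lemma Mop_ext0_zero (X : Fin 4 → ℝ) : Mop (bigH h) (ext0 P) (ext0 Q) X 0 = 0 := by
  simp [Mop]

variable {h P Q} in
lemma Mop_ext0_succ (hs : ∀ i j, h i j = h j i) (hP : ∀ i j, P i j = P j i)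
    (hQ : ∀ i j, Q i j = Q j i) (j : Fin 3) :
    Mop (bigH h) (ext0 P) (ext0 Q) (vecOf (bigH h) (ell h ω)) j.succ
      = -mv3 Q (raise3 h (mv3 P (raise3 h ω))) j := by
  have e : Mop (bigH h) (ext0 P) (ext0 Q) (vecOf (bigH h) (ell h ω)) j.succ
      = -∑ m, ∑ s, ∑ n, raise3 h ω m * P m s * h s n * Q n j := by
    simp [Mop, sum_four, vecOf_ell_succ]
  rw [e]
  generalize raise3 h ω = X
  simp only [mv3, raise3, hQ j]
  simp only [Fin.sum_univ_three, hs 1 0, hs 2 0, hs 2 1, hP 1 0, hP 2 0, hP 2 1]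
  ring

end Lift

lemma raise3_mul_comm {h : Fin 3 → Fin 3 → ℝ} (hs : ∀ i j, h i j = h j i) (v w : Fin 3 → ℝ) :
    ∑ i, raise3 h v i * w i = ∑ i, raise3 h w i * v i := by
  simp only [raise3, Fin.sum_univ_three, hs 1 0, hs 2 0, hs 2 1]
  ring

lemma mv3_mul_comm {P : Fin 3 → Fin 3 → ℝ} (hs : ∀ i j, P i j = P j i) (X Y : Fin 3 → ℝ) :
    ∑ i, X i * mv3 P Y i = ∑ i, Y i * mv3 P X i := by
  simp only [mv3, Fin.sum_univ_three, hs 1 0, hs 2 0, hs 2 1]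
  ring

lemma dot3_eq {h : Fin 3 → Fin 3 → ℝ} (v w : Fin 3 → ℝ) :
    dot3 h v w = ∑ i, raise3 h w i * v i := by
  simp only [dot3, raise3, Fin.sum_univ_three]
  ring

/-- Trace of the symmetrized product of two covectors. -/
lemma trH_symProd {h : Fin 3 → Fin 3 → ℝ} (hs : ∀ i j, h i j = h j i) (v w : Fin 3 → ℝ) :
    trH h (fun i j => v i * w j + v j * w i) = 2 * ∑ i, raise3 h v i * w i := by
  simp only [trH, raise3, Fin.sum_univ_three, hs 1 0, hs 2 0, hs 2 1]
  ring

lemma trH_symProd3 {h P Q : Fin 3 → Fin 3 → ℝ} (hs : ∀ i j, h i j = h j i)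
    (hQ : ∀ i j, Q i j = Q j i) : trH h (symProd3 h P Q) = 2 * pair3 h P Q := by
  simp only [trH, symProd3, pair3, Fin.sum_univ_three, hs 1 0, hs 2 0, hs 2 1,
    hQ 1 0, hQ 2 0, hQ 2 1]
  ring

/-- Contraction of the symmetrized product with a vector. -/
lemma contract_symProd3 {h P Q : Fin 3 → Fin 3 → ℝ} (hs : ∀ i j, h i j = h j i)
    (hP : ∀ i j, P i j = P j i) (hQ : ∀ i j, Q i j = Q j i) (X : Fin 3 → ℝ) (j : Fin 3) :
    ∑ k, X k * symProd3 h P Q k j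
      = mv3 Q (raise3 h (mv3 P X)) j + mv3 P (raise3 h (mv3 Q X)) j := by
  simp only [symProd3, mv3, raise3, hQ _ j]
  simp only [Fin.sum_univ_three, hs 1 0, hs 2 0, hs 2 1, hQ 1 0, hQ 2 0, hQ 2 1,
    hP 1 0, hP 2 0, hP 2 1]
  ring

/-- Elements of the range of `P̄²_N` are characterized by `S_{Nj} = (tr S) N♭_j`. -/
lemma P2_eq_self {g h : Fin 3 → Fin 3 → ℝ} {N : Fin 3 → ℝ} {S : Fin 3 → Fin 3 → ℝ}
    (hN : ∑ k, N k * flatN g N k = 1)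
    (hS : ∀ j, ∑ k, N k * S k j = trH h S * flatN g N j) (i j : Fin 3) :
    P2 g h N S i j = S i j := by
  have hq : quadN N S = trH h S := by
    have : quadN N S = ∑ j, N j * ∑ k, N k * S k j := by
      simp only [quadN, Fin.sum_univ_three]
      ring
    simp only [this, hS]
    simp only [Fin.sum_univ_three] at hN ⊢
    linear_combination trH h S * hN
  simp only [P2, hS, hq]
  ring

lemma inverse_symm_s13 {g h : Fin 3 → Fin 3 → ℝ} (hg : ∀ i j, g i j = g j i)
    (h₁ : ∀ i j, (∑ k, g i k * h k j) = if i = j then (1 : ℝ) else 0)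
    (i j : Fin 3) :
    h i j = h j i := by
  have e₁ : Matrix.of g * Matrix.of h = 1 := by
    ext i j; simpa [Matrix.mul_apply, Matrix.one_apply] using h₁ i j
  have e₂ : (Matrix.of h).transpose * Matrix.of g = 1 := by
    ext i j
    have := h₁ j i
    simp only [Matrix.mul_apply, Matrix.one_apply, Matrix.transpose_apply, Matrix.of_apply]
    rw [← (by simp [eq_comm] : (if j = i then (1 : ℝ) else 0) = if i = j then 1 else 0), ← this]
    exact Finset.sum_congr rfl fun k _ => by rw [hg k j, mul_comm]
  have := left_inv_eq_right_inv e₂ e₁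
  simpa using (congrFun (congrFun this j) i)

lemma mv3_raise3 {g h : Fin 3 → Fin 3 → ℝ}
    (h₁ : ∀ i j, (∑ k, g i k * h k j) = if i = j then (1 : ℝ) else 0) (v : Fin 3 → ℝ) :
    mv3 g (raise3 h v) = v := by
  ext i
  have : mv3 g (raise3 h v) i = ∑ j, (∑ k, g i k * h k j) * v j := by
    simp only [mv3, raise3, Fin.sum_univ_three]
    ring
  simp [this, h₁]

lemma dot3_self_pos {g h : Fin 3 → Fin 3 → ℝ}
    (hpos : ∀ ξ : Fin 3 → ℝ, ξ ≠ 0 → 0 < ∑ i, ∑ j, g i j * ξ i * ξ j)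
    (h₁ : ∀ i j, (∑ k, g i k * h k j) = if i = j then (1 : ℝ) else 0)
    {v : Fin 3 → ℝ} (hv : v ≠ 0) : 0 < dot3 h v v := by
  have hm := mv3_raise3 h₁ v
  have hne : raise3 h v ≠ 0 := by
    intro h0
    apply hv
    rw [← hm, h0]
    ext i
    simp [mv3]
  have := hpos _ hne
  have e : ∑ i, ∑ j, g i j * raise3 h v i * raise3 h v j
      = ∑ i, raise3 h v i * mv3 g (raise3 h v) i := by
    simp only [mv3, Fin.sum_univ_three]
    ring
  rwa [e, hm, ← dot3_eq] at this

lemma nrm3_sq {g h : Fin 3 → Fin 3 → ℝ}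
    (hpos : ∀ ξ : Fin 3 → ℝ, ξ ≠ 0 → 0 < ∑ i, ∑ j, g i j * ξ i * ξ j)
    (h₁ : ∀ i j, (∑ k, g i k * h k j) = if i = j then (1 : ℝ) else 0)
    {v : Fin 3 → ℝ} (hv : v ≠ 0) : nrm3 h v ^ 2 = dot3 h v v :=
  Real.sq_sqrt (dot3_self_pos hpos h₁ hv).le

/-- Contraction of `N ⊗̃ X` with the unit vector `N`. -/
lemma contract_tens {g : Fin 3 → Fin 3 → ℝ} (hg : ∀ i j, g i j = g j i) {N : Fin 3 → ℝ}
    (hN : ∑ k, N k * flatN g N k = 1) (X : Fin 3 → ℝ) (j : Fin 3) :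
    ∑ k, N k * tens g N X k j = X j + (1 / 2) * (∑ k, N k * X k) * flatN g N j := by
  have e : ∑ k, N k * tens g N X k j = (∑ k, N k * flatN g N k) * X j
      + flatN g N j * (∑ k, N k * X k) - (1 / 2) * (∑ k, N k * X k) * ∑ k, g k j * N k := by
    simp only [tens, Fin.sum_univ_three]
    ring
  have e' : ∑ k, g k j * N k = flatN g N j :=
    Finset.sum_congr rfl fun k _ => by rw [hg k j]
  rw [e, hN, e']
  ring

/-- Trace of `N ⊗̃ X`. -/
lemma trH_tens {g h : Fin 3 → Fin 3 → ℝ} (hg : ∀ i j, g i j = g j i)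
    (hs : ∀ i j, h i j = h j i)
    (h₂ : ∀ i j, (∑ k, h i k * g k j) = if i = j then (1 : ℝ) else 0) (N X : Fin 3 → ℝ) :
    trH h (tens g N X) = (1 / 2) * ∑ k, N k * X k := by
  have hN : ∀ i, raise3 h (flatN g N) i = N i := fun i => by
    rw [show flatN g N = mv3 g N from rfl]
    exact congrFun (mv3_raise3 h₂ N) i
  have hgh : ∑ i, ∑ j, h i j * g i j = 3 := by
    have : ∀ i, ∑ j, h i j * g i j = 1 := fun i => by
      simpa [hg i] using h₂ i i
    simp [this]
  have e : trH h (tens g N X) = (∑ k, raise3 h (flatN g N) k * X k)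
      + (∑ k, raise3 h (flatN g N) k * X k)
      - (1 / 2) * (∑ k, N k * X k) * ∑ i, ∑ j, h i j * g i j := by
    simp only [trH, tens, raise3, Fin.sum_univ_three, hs 1 0, hs 2 0, hs 2 1]
    ring
  simp only [hN, hgh] at e
  rw [e]
  ring

/-- The spatial part of `J`. -/
noncomputable def Jbar (p ε : ℝ) (w x y : Fin 3 → ℝ) : Fin 3 → ℝ :=
  fun j => -(1 / 8) * p * w j + (1 / 4) * x j + (ε / 4) * y j

section Interaction

variable {h P Q : Fin 3 → Fin 3 → ℝ} (A B : Fin 3 → ℝ) (ε : ℝ)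

lemma I12_zero_succ (hs : ∀ i j, h i j = h j i) (hP : ∀ i j, P i j = P j i)
    (hQ : ∀ i j, Q i j = Q j i) (j : Fin 3) :
    I12 h P Q A B ε 0 j.succ =
      let x := mv3 P (raise3 h (mv3 Q (raise3 h A)))
      let y := mv3 Q (raise3 h (mv3 P (raise3 h B)))
      let a := nrm3 h A
      let b := nrm3 h B
      let p := pair3 h P Q
      (ε / 4) * (-a * y j - b * x j + (1 / 2) * p * (a * B j + b * A j))
        + (a + ε * b) * Jbar p ε (wbar A B ε) x y j
        - (1 / 8) * p * (a + ε * b) * wbar A B ε j := by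
  simp only [I12, Icor, P0, Jcov, dotg_ext0, app1_ext0_zero, Mop_ext0_zero,
    Mop_ext0_succ A hs hQ hP, Mop_ext0_succ B hs hP hQ, ext0_zero_left, ext0_zero_right,
    ell_zero, ell_succ, zero_mul, mul_zero, add_zero, Finset.sum_const_zero, Jbar, wbar]
  ring

lemma I12_succ_succ (hs : ∀ i j, h i j = h j i) (hP : ∀ i j, P i j = P j i)
    (hQ : ∀ i j, Q i j = Q j i) (i j : Fin 3) :
    I12 h P Q A B ε i.succ j.succ =
      let u := mv3 P (raise3 h B)
      let v := mv3 Q (raise3 h A)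
      let x := mv3 P (raise3 h v)
      let y := mv3 Q (raise3 h u)
      let p := pair3 h P Q
      let w := wbar A B ε
      let J := Jbar p ε w x y;
      -(1 / 4) * ((∑ k, raise3 h A k * v k) * P i j + (∑ k, raise3 h B k * u k) * Q i j)
        + (ε / 4) * (-(A i * y j + A j * y i) - (B i * x j + B j * x i)
          + (1 / 2) * p * (A i * B j + A j * B i) + (u i * v j + u j * v i)
          - (dot3 h A B - nrm3 h A * nrm3 h B) * symProd3 h P Q i j)
        + (w i * J j + w j * J i) := by
  have hz : ∑ σ, ∑ ν, bigH h σ ν *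
      (ext0 P i.succ σ * ext0 Q ν j.succ + ext0 P j.succ σ * ext0 Q ν i.succ)
      = symProd3 h P Q i j := by
    simp [sum_four, symProd3]
  simp only [I12, Icor, P0, Jcov, dotg_ext0, app1_ext0_succ, app2_ext0, hBil_ell,
    Mop_ext0_succ A hs hQ hP, Mop_ext0_succ B hs hP hQ, hz, ext0_succ_succ, ell_succ, Jbar, wbar]
  ring

lemma Xh_eq (hP : ∀ i j, P i j = P j i)
    (hQ : ∀ i j, Q i j = Q j i) (j : Fin 3) :
    Xh h P Q A B ε j =
      let x := mv3 P (raise3 h (mv3 Q (raise3 h A)))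
      let y := mv3 Q (raise3 h (mv3 P (raise3 h B)))
      let a := nrm3 h A
      let b := nrm3 h B;
      -(1 / 8) * b * y j - (1 / 8) * a * x j
        + ((1 / 8) * (a * A j + b * B j) + (ε / 16) * (b * A j + a * B j)) * pair3 h P Q := by
  have key : ∀ (R S : Fin 3 → Fin 3 → ℝ) (ω : Fin 3 → ℝ), (∀ i j, S i j = S j i) →
      ∑ b, ∑ c, ∑ d, ∑ e, h b c * R c d * h d e * ω e * S b j
        = mv3 S (raise3 h (mv3 R (raise3 h ω))) j := by
    intro R S ω hS
    simp only [mv3, raise3, Finset.mul_sum, hS j]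
    refine Finset.sum_congr rfl fun b _ => Finset.sum_congr rfl fun c _ =>
      Finset.sum_congr rfl fun d _ => Finset.sum_congr rfl fun e _ => by ring
  simp only [Xh, key P Q B hQ, key Q P A hP, pair3]
  ring

lemma Hww_eq : Hww h A B ε
    = dot3 h (wbar A B ε) (wbar A B ε) - (nrm3 h A + ε * nrm3 h B) ^ 2 := by
  simp [Hww, hBil, wcov, dot3, wbar, sum_four]
  ring

lemma dot3_wbar_self (hs : ∀ i j, h i j = h j i) : dot3 h (wbar A B ε) (wbar A B ε)
    = dot3 h A A + ε ^ 2 * dot3 h B B + 2 * ε * dot3 h A B := by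
  simp only [dot3, wbar, Fin.sum_univ_three, hs 1 0, hs 2 0, hs 2 1]
  ring

end Interaction

/-- The polarization identity satisfied by `𝓘^{(0,ε)}`. -/
lemma I12_polarization {h P Q : Fin 3 → Fin 3 → ℝ} {A B : Fin 3 → ℝ} {ε : ℝ}
    (hs : ∀ i j, h i j = h j i) (hP : ∀ i j, P i j = P j i) (hQ : ∀ i j, Q i j = Q j i)
    (htP : trH h P = 0) (htQ : trH h Q = 0)
    (hPA : ∀ i, mv3 P (raise3 h A) i = 0) (hQB : ∀ i, mv3 Q (raise3 h B) i = 0)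
    (hε : ε = 1 ∨ ε = -1) (ha : nrm3 h A ^ 2 = dot3 h A A) (hb : nrm3 h B ^ 2 = dot3 h B B)
    (j : Fin 3) :
    (nrm3 h A + ε * nrm3 h B)
        * (trH h (fun i k => I12 h P Q A B ε i.succ k.succ) * wbar A B ε j
          - ∑ k, raise3 h (wbar A B ε) k * I12 h P Q A B ε k.succ j.succ)
      + dot3 h (wbar A B ε) (wbar A B ε) * I12 h P Q A B ε 0 j.succ
      - (∑ k, raise3 h (wbar A B ε) k * I12 h P Q A B ε 0 k.succ) * wbar A B ε j
      = -2 * Hww h A B ε * Xh h P Q A B ε j := by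
  have hw : ∀ k, raise3 h (wbar A B ε) k = raise3 h A k + ε * raise3 h B k := by
    intro k
    simp only [raise3, wbar, Fin.sum_univ_three]
    ring
  have hZ := trH_symProd3 (P := P) hs hQ
  have hZA := contract_symProd3 hs hP hQ (raise3 h A) j
  have hZB := contract_symProd3 hs hP hQ (raise3 h B) j
  rw [show mv3 P (raise3 h A) = fun _ => 0 from funext hPA] at hZA
  rw [show mv3 Q (raise3 h B) = fun _ => 0 from funext hQB] at hZB
  have h0 : ∀ R : Fin 3 → Fin 3 → ℝ, mv3 R (raise3 h fun _ => 0) j = 0 := fun R => by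
    simp [mv3, raise3]
  rw [h0, zero_add] at hZA
  rw [h0, add_zero] at hZB
  have hAA := dot3_eq (h := h) A A
  have hBB := dot3_eq (h := h) B B
  have hAB := dot3_eq (h := h) A B
  have hBA := hAB.trans (raise3_mul_comm hs B A)
  have hAu : ∑ k, raise3 h A k * mv3 P (raise3 h B) k = 0 := by
    rw [mv3_mul_comm hP]; simp [hPA]
  have hBv : ∑ k, raise3 h B k * mv3 Q (raise3 h A) k = 0 := by
    rw [mv3_mul_comm hQ]; simp [hQB]
  have hPAj : ∑ k, raise3 h A k * P k j = 0 := by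
    rw [← hPA j]; exact Finset.sum_congr rfl fun k _ => by rw [hP k j, mul_comm]
  have hQBj : ∑ k, raise3 h B k * Q k j = 0 := by
    rw [← hQB j]; exact Finset.sum_congr rfl fun k _ => by rw [hQ k j, mul_comm]
  have hPBj : ∑ k, raise3 h B k * P k j = mv3 P (raise3 h B) j :=
    Finset.sum_congr rfl fun k _ => by rw [hP k j, mul_comm]
  have hQAj : ∑ k, raise3 h A k * Q k j = mv3 Q (raise3 h A) j :=
    Finset.sum_congr rfl fun k _ => by rw [hQ k j, mul_comm]
  have hAx : ∑ k, raise3 h A k * mv3 P (raise3 h (mv3 Q (raise3 h A))) k = 0 := by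
    rw [mv3_mul_comm hP]; simp [hPA]
  have hBy : ∑ k, raise3 h B k * mv3 Q (raise3 h (mv3 P (raise3 h B))) k = 0 := by
    rw [mv3_mul_comm hQ]; simp [hQB]
  have hBx : ∑ k, raise3 h B k * mv3 P (raise3 h (mv3 Q (raise3 h A))) k
      = ∑ k, raise3 h (mv3 P (raise3 h B)) k * mv3 Q (raise3 h A) k := by
    rw [mv3_mul_comm hP, raise3_mul_comm hs]
  have hAy : ∑ k, raise3 h A k * mv3 Q (raise3 h (mv3 P (raise3 h B))) k
      = ∑ k, raise3 h (mv3 P (raise3 h B)) k * mv3 Q (raise3 h A) k := by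
    rw [mv3_mul_comm hQ]
  simp only [I12_zero_succ A B ε hs hP hQ, I12_succ_succ A B ε hs hP hQ, Hww_eq,
    Xh_eq A B ε hP hQ, dot3_wbar_self A B ε hs]
  set u := mv3 P (raise3 h B)
  set v := mv3 Q (raise3 h A)
  set x := mv3 P (raise3 h v)
  set y := mv3 Q (raise3 h u)
  set w := wbar A B ε with hwdef
  set a := nrm3 h A
  set b := nrm3 h B
  set c := dot3 h A B
  set p := pair3 h P Q
  set Z := symProd3 h P Q
  set q := ∑ k, raise3 h u k * v k with hq
  have hAwJ : ∀ D : Fin 3 → ℝ, ∑ k, D k * Jbar p ε w x y k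
      = -(1 / 8) * p * (∑ k, D k * A k + ε * ∑ k, D k * B k)
        + (1 / 4) * (∑ k, D k * x k) + (ε / 4) * ∑ k, D k * y k := by
    intro D
    simp only [Jbar, hwdef, wbar, Fin.sum_univ_three]
    ring
  have hDw : ∀ D : Fin 3 → ℝ, ∑ k, D k * w k = ∑ k, D k * A k + ε * ∑ k, D k * B k := by
    intro D
    simp only [hwdef, wbar, Fin.sum_univ_three]
    ring
  set J := Jbar p ε w x y with hJ
  set β := ∑ k, raise3 h A k * v k with hβ
  set α := ∑ k, raise3 h B k * u k with hα
  have hT : trH h (fun i k => -(1 / 4) * (β * P i k + α * Q i k)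
        + (ε / 4) * (-(A i * y k + A k * y i) - (B i * x k + B k * x i)
          + (1 / 2) * p * (A i * B k + A k * B i) + (u i * v k + u k * v i)
          - (c - a * b) * Z i k)
        + (w i * J k + w k * J i))
      = -(1 / 4) * (β * trH h P + α * trH h Q)
        + (ε / 4) * (-(2 * ∑ i, raise3 h A i * y i) - 2 * (∑ i, raise3 h B i * x i)
          + (1 / 2) * p * (2 * ∑ i, raise3 h B i * A i) + 2 * (∑ i, raise3 h u i * v i)
          - (c - a * b) * trH h Z)
        + 2 * ∑ i, raise3 h w i * J i := by
    rw [raise3_mul_comm hs B A]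
    simp only [← trH_symProd hs]
    simp only [trH, Fin.sum_univ_three]
    ring
  have hC : ∀ D : Fin 3 → ℝ, ∑ k, D k * (-(1 / 4) * (β * P k j + α * Q k j)
        + (ε / 4) * (-(A k * y j + A j * y k) - (B k * x j + B j * x k)
          + (1 / 2) * p * (A k * B j + A j * B k) + (u k * v j + u j * v k)
          - (c - a * b) * Z k j)
        + (w k * J j + w j * J k))
      = -(1 / 4) * (β * (∑ k, D k * P k j) + α * ∑ k, D k * Q k j)
        + (ε / 4) * (-((∑ k, D k * A k) * y j + A j * ∑ k, D k * y k)
          - ((∑ k, D k * B k) * x j + B j * ∑ k, D k * x k)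
          + (1 / 2) * p * ((∑ k, D k * A k) * B j + A j * ∑ k, D k * B k)
          + ((∑ k, D k * u k) * v j + u j * ∑ k, D k * v k)
          - (c - a * b) * ∑ k, D k * Z k j)
        + ((∑ k, D k * w k) * J j + w j * ∑ k, D k * J k) := by
    intro D
    simp only [Fin.sum_univ_three]
    ring
  have hC0 : ∀ D : Fin 3 → ℝ, ∑ k, D k * ((ε / 4) * (-a * y k - b * x k
          + (1 / 2) * p * (a * B k + b * A k))
        + (a + ε * b) * J k - (1 / 8) * p * (a + ε * b) * w k)
      = (ε / 4) * (-a * (∑ k, D k * y k) - b * (∑ k, D k * x k)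
          + (1 / 2) * p * (a * (∑ k, D k * B k) + b * ∑ k, D k * A k))
        + (a + ε * b) * (∑ k, D k * J k)
        - (1 / 8) * p * (a + ε * b) * ∑ k, D k * w k := by
    intro D
    simp only [Fin.sum_univ_three]
    ring
  have hsplit : ∀ f : Fin 3 → ℝ, ∑ k, raise3 h w k * f k
      = ∑ k, raise3 h A k * f k + ε * ∑ k, raise3 h B k * f k := by
    intro f
    simp only [hw, Fin.sum_univ_three]
    ring
  simp only [hT, hsplit, hC, hC0, hAwJ, hDw, htP, htQ, hZ, hZA, hZB, ← hAA, ← hBB, ← hAB, ← hBA,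
    ← ha, ← hb, ← hq, ← hα, ← hβ, hAu, hBv, hAx, hBy, hBx, hAy, hPAj, hQBj, hPBj, hQAj]
  simp only [hJ, hwdef, Jbar, wbar]
  rcases hε with rfl | rfl <;> ring

lemma Hww_ne_zero {h : Fin 3 → Fin 3 → ℝ} {A B : Fin 3 → ℝ} {ε : ℝ}
    (hs : ∀ i j, h i j = h j i) (hε : ε = 1 ∨ ε = -1)
    (ha : nrm3 h A ^ 2 = dot3 h A A) (hb : nrm3 h B ^ 2 = dot3 h B B)
    (hang : dot3 h A B ≠ nrm3 h A * nrm3 h B) : Hww h A B ε ≠ 0 := by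
  have e : Hww h A B ε = 2 * ε * (dot3 h A B - nrm3 h A * nrm3 h B) := by
    rw [Hww_eq, dot3_wbar_self A B ε hs, ← ha, ← hb]
    ring
  rw [e]
  have : ε ≠ 0 := by rcases hε with rfl | rfl <;> norm_num
  exact mul_ne_zero (mul_ne_zero two_ne_zero this) (sub_ne_zero.2 hang)

/-- the initial-data matching identity for the mixed-harmonic part of the
second fundamental form: with `F^{(2,ε)} = −𝓘/𝐡(w,w)`,
`P̄²_{N_w}(κ) − (N_w ⊗̃ X̂)/|∇w| = (1/2)[(|ω_A|+ε|ω_B|) F^{(2,ε)}_{ij}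
  − (w̄_i F^{(2,ε)}_{0j} + w̄_j F^{(2,ε)}_{0i})]`, equivalently `P̄²_{N_w}(κ) = κ`. -/
theorem statement13
    (g h : Fin 3 → Fin 3 → ℝ)
    (hg_symm : ∀ i j, g i j = g j i)
    (hg_pos : ∀ ξ : Fin 3 → ℝ, ξ ≠ 0 → 0 < ∑ i, ∑ j, g i j * ξ i * ξ j)
    (h_inv₁ : ∀ i j, (∑ k, g i k * h k j) = if i = j then (1 : ℝ) else 0)
    (h_inv₂ : ∀ i j, (∑ k, h i k * g k j) = if i = j then (1 : ℝ) else 0)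
    (ωA ωB : Fin 3 → ℝ) (hωA : ωA ≠ 0) (hωB : ωB ≠ 0)
    (ε : ℝ) (hε : ε = 1 ∨ ε = -1)
    (FbA FbB : Fin 3 → Fin 3 → ℝ)
    (hFbA_symm : ∀ i j, FbA i j = FbA j i) (hFbB_symm : ∀ i j, FbB i j = FbB j i)
    (hFbA_tr : (∑ i, ∑ j, h i j * FbA i j) = 0)
    (hFbB_tr : (∑ i, ∑ j, h i j * FbB i j) = 0)
    (hFbA_trans : ∀ i, (∑ j, ∑ k, FbA i j * h j k * ωA k) = 0)
    (hFbB_trans : ∀ i, (∑ j, ∑ k, FbB i j * h j k * ωB k) = 0)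
    (hw_ne : wbar ωA ωB ε ≠ 0)
    (hang : (∑ i, ∑ j, h i j * ωA i * ωB j) ≠ nrm3 h ωA * nrm3 h ωB) :
    (∀ i j,
      P2 g h (Nw h ωA ωB ε) (kap g h FbA FbB ωA ωB ε) i j
        - tens g (Nw h ωA ωB ε) (Xh h FbA FbB ωA ωB ε) i j / nrm3 h (wbar ωA ωB ε)
      = (1 / 2) * ((nrm3 h ωA + ε * nrm3 h ωB)
            * (-(I12 h FbA FbB ωA ωB ε i.succ j.succ) / Hww h ωA ωB ε)
          - (wbar ωA ωB ε i * (-(I12 h FbA FbB ωA ωB ε 0 j.succ) / Hww h ωA ωB ε)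
            + wbar ωA ωB ε j * (-(I12 h FbA FbB ωA ωB ε 0 i.succ) / Hww h ωA ωB ε))))
    ∧ (∀ i j,
      P2 g h (Nw h ωA ωB ε) (kap g h FbA FbB ωA ωB ε) i j
        = kap g h FbA FbB ωA ωB ε i j) := by
  have hs := inverse_symm_s13 hg_symm h_inv₁
  have ha := nrm3_sq hg_pos h_inv₁ hωA
  have hb := nrm3_sq hg_pos h_inv₁ hωB
  have hn := nrm3_sq hg_pos h_inv₁ hw_ne
  have hwpos := dot3_self_pos hg_pos h_inv₁ hw_ne
  have hmv : ∀ (R : Fin 3 → Fin 3 → ℝ) (ω : Fin 3 → ℝ) (i : Fin 3),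
      mv3 R (raise3 h ω) i = ∑ j, ∑ k, R i j * h j k * ω k := by
    intro R ω i
    simp only [mv3, raise3, Finset.mul_sum, mul_assoc]
  have hpol := I12_polarization (ε := ε) hs hFbA_symm hFbB_symm hFbA_tr hFbB_tr
    (fun i => (hmv _ _ i).trans (hFbA_trans i)) (fun i => (hmv _ _ i).trans (hFbB_trans i))
    hε ha hb
  have hH : Hww h ωA ωB ε ≠ 0 := Hww_ne_zero hs hε ha hb hang
  have hn0 : nrm3 h (wbar ωA ωB ε) ≠ 0 := by
    intro h0
    rw [h0] at hn
    norm_num at hn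
    exact hwpos.ne hn
  have hNk : ∀ k, Nw h ωA ωB ε k
      = raise3 h (wbar ωA ωB ε) k / nrm3 h (wbar ωA ωB ε) := fun _ => rfl
  have hflat : ∀ k, flatN g (Nw h ωA ωB ε) k
      = wbar ωA ωB ε k / nrm3 h (wbar ωA ωB ε) := by
    intro k
    rw [← congrFun (mv3_raise3 h_inv₁ (wbar ωA ωB ε)) k]
    simp only [flatN, mv3, hNk, Finset.sum_div, mul_div_assoc]
  have hrw := dot3_eq (h := h) (wbar ωA ωB ε) (wbar ωA ωB ε)
  rw [← hn] at hrw
  have hN : ∑ k, Nw h ωA ωB ε k * flatN g (Nw h ωA ωB ε) k = 1 := by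
    simp only [hNk, hflat, div_mul_div_comm, ← Finset.sum_div, ← hrw]
    field_simp
  have hfix : ∀ i j, P2 g h (Nw h ωA ωB ε) (kap g h FbA FbB ωA ωB ε) i j
      = kap g h FbA FbB ωA ωB ε i j := by
    refine P2_eq_self hN fun j => ?_
    have htens := contract_tens hg_symm hN (Xh h FbA FbB ωA ωB ε) j
    have htr := trH_tens hg_symm hs h_inv₂ (Nw h ωA ωB ε) (Xh h FbA FbB ωA ωB ε)
    have hsym := trH_symProd hs (wbar ωA ωB ε) (fun k => I12 h FbA FbB ωA ωB ε 0 k.succ)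
    have hp := hpol j
    rw [← hn] at hp
    have htrk : trH h (kap g h FbA FbB ωA ωB ε)
        = (-(nrm3 h ωA + ε * nrm3 h ωB)
              * trH h (fun i k => I12 h FbA FbB ωA ωB ε i.succ k.succ)
            + trH h (fun i k => wbar ωA ωB ε i * I12 h FbA FbB ωA ωB ε 0 k.succ
              + wbar ωA ωB ε k * I12 h FbA FbB ωA ωB ε 0 i.succ)) / (2 * Hww h ωA ωB ε)
          + trH h (tens g (Nw h ωA ωB ε) (Xh h FbA FbB ωA ωB ε))
            / nrm3 h (wbar ωA ωB ε) := by
      simp only [trH, kap, Fin.sum_univ_three]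
      ring
    have hck : ∑ k, Nw h ωA ωB ε k * kap g h FbA FbB ωA ωB ε k j
        = (-(nrm3 h ωA + ε * nrm3 h ωB)
              * (∑ k, raise3 h (wbar ωA ωB ε) k * I12 h FbA FbB ωA ωB ε k.succ j.succ)
            + (∑ k, raise3 h (wbar ωA ωB ε) k * wbar ωA ωB ε k)
              * I12 h FbA FbB ωA ωB ε 0 j.succ
            + wbar ωA ωB ε j
              * ∑ k, raise3 h (wbar ωA ωB ε) k * I12 h FbA FbB ωA ωB ε 0 k.succ)
            / (2 * Hww h ωA ωB ε) / nrm3 h (wbar ωA ωB ε)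
          + (∑ k, Nw h ωA ωB ε k * tens g (Nw h ωA ωB ε) (Xh h FbA FbB ωA ωB ε) k j)
            / nrm3 h (wbar ωA ωB ε) := by
      simp only [kap, hNk, Fin.sum_univ_three]
      ring
    rw [hck, htrk, htens, htr, hsym, ← hrw, hflat]
    field_simp
    linear_combination nrm3 h (wbar ωA ωB ε) * hp
  refine ⟨fun i j => ?_, hfix⟩
  rw [hfix, kap]
  field_simp
  ring
end
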